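/- arXiv:0809.5267 — 2 statements merged into one kernel-verified Lean document; each statement's English description precedes it below -/
import Mathlib

section
/- Let (R, m) be a Noetherian local ring, and for nonzero x ∈ R write ord(x) for the m-adic order of x, the largest n with x ∈ m^n (finite by Krull's intersection theorem). The following are equivalent: (1) R is analytically irreducible, i.e., the m-adic completion R̂ is an integral domain; (2) R has bounded multiplication: there exists a function μ : ℕ × ℕ → ℕ such that ord(xy) ≤ μ(ord(x), ord(y)) for all nonzero x, y ∈ R; (3) for some (equivalently, every) nonprincipal ultrafilter u on ℕ, the catapower R♯ = R♮/⋂_n m^n·R♮ of R is an integral domain, where R♮ = (∏_{n∈ℕ} R)/{f : f(n)=0 for u-almost all n} is the ultrapower of R. -/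
/-!
STATEMENT 13: For a Noetherian local ring `(R, m)` the following are equivalent:
(1) `R` is analytically irreducible (the completion `R̂` is a domain);
(2) `R` has bounded multiplication: there is `μ : ℕ × ℕ → ℕ` with
    `ord(xy) ≤ μ(ord x, ord y)` for all nonzero `x, y` (in particular `xy ≠ 0`);
(3) for some (equivalently, every) nonprincipal ultrafilter `u` on `ℕ`, the catapower
    `R♯ = R♮/⋂ₙ m^n·R♮` is a domain.
Here `ord x` is the largest `n` with `x ∈ m^n`.
-/

universe u

open Filter

/-- The `m`-adic order of an element of a local ring (junk value for elements of
infinite order, e.g. `0`). -/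
noncomputable def ordR (R : Type u) [CommRing R] [IsLocalRing R] (x : R) : ℕ :=
  sSup {n : ℕ | x ∈ IsLocalRing.maximalIdeal R ^ n}

/-- The ideal of `ℕ → R` of functions vanishing `u`-almost everywhere. -/
def ultraZeroIdeal (u : Ultrafilter ℕ) (R : Type u) [CommRing R] : Ideal (ℕ → R) where
  carrier := {f | ∀ᶠ w in (u : Filter ℕ), f w = 0}
  zero_mem' := Eventually.of_forall fun _ => rfl
  add_mem' := by
    intro a b ha hb
    filter_upwards [ha, hb] with w h1 h2
    simp [h1, h2]
  smul_mem' := by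
    intro c f hf
    filter_upwards [hf] with w h
    simp [h]

/-- The ultrapower of `R` along the ultrafilter `u`. -/
abbrev Ultrapower (u : Ultrafilter ℕ) (R : Type u) [CommRing R] :=
  (ℕ → R) ⧸ ultraZeroIdeal u R

/-- The diagonal embedding of `R` into its ultrapower. -/
def ultraDiag (u : Ultrafilter ℕ) (R : Type u) [CommRing R] : R →+* Ultrapower u R :=
  (Ideal.Quotient.mk (ultraZeroIdeal u R)).comp (Pi.constRingHom ℕ R)

/-- The catapower of a local ring `R`. -/
abbrev Catapower (u : Ultrafilter ℕ) (R : Type u) [CommRing R] [IsLocalRing R] :=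
  Ultrapower u R ⧸
    (⨅ n : ℕ, Ideal.map (ultraDiag u R) (IsLocalRing.maximalIdeal R ^ n))

open IsLocalRing

theorem adicCompletion_isNoetherianRing (R : Type u) [CommRing R] [IsNoetherianRing R]
    (I : Ideal R) : IsNoetherianRing (AdicCompletion I R) := by
  obtain ⟨s, hs⟩ : I.FG := IsNoetherian.noetherian I
  let φ : MvPolynomial s R →ₐ[R] R := MvPolynomial.aeval Subtype.val
  have hφ : (MvPolynomial.idealOfVars s R).map φ = I := by
    rw [Ideal.map_span, ← hs, ← Set.range_comp]
    congr 1
    ext y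
    simp [φ]
  have hle (n : ℕ) : ∀ p ∈ MvPolynomial.idealOfVars s R ^ n, φ p ∈ I ^ n := fun p hp => by
    rw [← hφ, ← Ideal.map_pow]
    exact Ideal.mem_map_of_mem _ hp
  let f (n : ℕ) : MvPowerSeries s R →+* R ⧸ I ^ n :=
    (Ideal.Quotient.lift (MvPolynomial.idealOfVars s R ^ n)
      ((Ideal.Quotient.mk (I ^ n)).comp (φ : MvPolynomial s R →+* R))
      (fun p hp => Ideal.Quotient.eq_zero_iff_mem.mpr (hle n p hp))).comp
    (MvPowerSeries.truncTotalAlgHom s R n : MvPowerSeries s R →+* _)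
  have f_apply (n : ℕ) (p) : f n p = Ideal.Quotient.mk (I ^ n) (φ (p.truncTotal n)) := rfl
  have hf {m n : ℕ} (hmn : m ≤ n) : (Ideal.Quotient.factorPow I hmn).comp (f n) = f m := by
    ext p
    simp only [RingHom.comp_apply, f_apply]
    change Ideal.Quotient.mk (I ^ m) _ = _
    rw [Ideal.Quotient.eq, ← map_sub]
    exact hle m _ (MvPowerSeries.truncTotal_sub_truncTotal_mem_pow_idealOfVars hmn le_rfl p)
  let F : MvPowerSeries s R →+* AdicCompletion I R := AdicCompletion.liftRingHom I f hf
  have hF (p : MvPolynomial s R) : F p = algebraMap R _ (φ p) := by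
    refine AdicCompletion.ext_evalₐ fun n => ?_
    rw [AdicCompletion.evalₐ_liftRingHom, f_apply, AdicCompletion.algebraMap_apply]
    rw [Algebra.algebraMap_self, RingHom.id_apply, AdicCompletion.evalₐ_of]
    rw [Ideal.Quotient.eq, ← map_sub]
    refine hle n _ ?_
    rw [MvPolynomial.mem_pow_idealOfVars_iff']
    intro x h
    rw [MvPolynomial.coeff_sub, sub_eq_zero, MvPowerSeries.coeff_truncTotal _ h,
      MvPolynomial.coeff_coe]
  have hmap : (Ideal.span (Set.range MvPowerSeries.X) : Ideal (MvPowerSeries s R)).map F =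
      I.map (algebraMap R (AdicCompletion I R)) := by
    trans ((MvPolynomial.idealOfVars s R).map φ).map (algebraMap R (AdicCompletion I R))
    · rw [Ideal.map_span, Ideal.map_span, Ideal.map_span, ← Set.range_comp, ← Set.range_comp,
        ← Set.range_comp]
      congr 2
      funext i
      simp [← MvPolynomial.coe_X, hF]
    · rw [hφ]
  have hc := AdicCompletion.isAdicComplete_self I (IsNoetherian.noetherian I)
  rw [← hmap] at hc
  refine isNoetherianRing_of_surjective (MvPowerSeries s R) _ F
    (surjective_of_mk_map_comp_surjective F
      (I := Ideal.span (Set.range MvPowerSeries.X)) fun y => ?_)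
  obtain ⟨y, rfl⟩ := Ideal.Quotient.mk_surjective y
  obtain ⟨r, hr⟩ := Ideal.Quotient.mk_surjective (AdicCompletion.evalOneₐ I y)
  refine ⟨(MvPolynomial.C r : MvPolynomial s R), ?_⟩
  rw [RingHom.comp_apply, Ideal.Quotient.eq, hmap,
    ← AdicCompletion.ker_evalOneₐ_eq_map I (IsNoetherian.noetherian I), hF]
  simp only [RingHom.mem_ker, AlgHom.toRingHom_eq_coe, RingHom.coe_coe, map_sub, ← hr, φ]
  rw [sub_eq_zero, AlgHom.commutes, MvPolynomial.aeval_C]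
  rfl

theorem exists_pow_le_of_iInf_eq_bot (C : Type u) [CommRing C] [IsLocalRing C]
    [IsNoetherianRing C] [IsAdicComplete (maximalIdeal C) C] (I : ℕ → Ideal C)
    (hanti : Antitone I) (hbot : ⨅ n, I n = ⊥) (hpow : ∀ n, maximalIdeal C ^ n ≤ I n) (a : ℕ) :
    ∃ n, I n ≤ maximalIdeal C ^ a := by
  set m := maximalIdeal C
  have hstab (k : ℕ) : ∃ N, ∀ n, N ≤ n → I N ⊔ m ^ k = I n ⊔ m ^ k := by
    rcases eq_or_ne (m ^ k) ⊤ with hk | hk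
    · exact ⟨0, fun n _ => by simp [hk]⟩
    have : Nontrivial (C ⧸ m ^ k) := Ideal.Quotient.nontrivial_iff.mpr hk
    have : IsLocalRing (C ⧸ m ^ k) := .of_surjective' _ Ideal.Quotient.mk_surjective
    have : IsArtinianRing (C ⧸ m ^ k) := by
      rw [isArtinianRing_iff_isNilpotent_maximalIdeal]
      refine ⟨k, ?_⟩
      have : maximalIdeal (C ⧸ m ^ k) = m.map (Ideal.Quotient.mk (m ^ k)) :=
        (IsLocalRing.map_maximalIdeal_of_surjective _ Ideal.Quotient.mk_surjective).symm
      rw [this, ← Ideal.map_pow, Ideal.map_quotient_self]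
      rfl
    obtain ⟨N, hN⟩ := IsArtinian.monotone_stabilizes (R := C ⧸ m ^ k) (M := C ⧸ m ^ k)
      ⟨fun n => OrderDual.toDual ((I n).map (Ideal.Quotient.mk (m ^ k))),
        fun i j hij => Ideal.map_mono (hanti hij)⟩
    refine ⟨N, fun n hn => ?_⟩
    have h : (I N).map (Ideal.Quotient.mk (m ^ k)) = (I n).map (Ideal.Quotient.mk (m ^ k)) :=
      hN n hn
    have := congrArg (Ideal.comap (Ideal.Quotient.mk (m ^ k))) h
    simpa [Ideal.comap_map_of_surjective' _ Ideal.Quotient.mk_surjective] using this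
  choose N hN using hstab
  by_contra! hcon
  obtain ⟨z₀, hz₀, hz₀a⟩ := Set.not_subset.mp (hcon (N a + a))
  have hmem (k n : ℕ) (hn : N k ≤ n) (z : C) (hz : z ∈ I (N k)) : ∃ z' ∈ I n, z' - z ∈ m ^ k := by
    have : z ∈ I n ⊔ m ^ k := hN k n hn ▸ Ideal.mem_sup_left hz
    obtain ⟨y, hy, w, hw, rfl⟩ := Submodule.mem_sup.mp this
    exact ⟨y, hy, by simpa using neg_mem hw⟩
  have hstep (k : ℕ) (z : C) (hz : z ∈ I (N k + k)) :
      ∃ z' ∈ I (N (k + 1) + (k + 1)), z' - z ∈ m ^ k := by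
    obtain ⟨z', h1, h2⟩ := hmem k (N k + N (k + 1) + (k + 1)) (by lia) z (hanti (by lia) hz)
    exact ⟨z', hanti (by lia) h1, h2⟩
  choose! g hg1 hg2 using hstep
  let z : ℕ → C := fun k => Nat.rec z₀ (fun i w => g (a + i) w) k
  have hz (k : ℕ) : z k ∈ I (N (a + k) + (a + k)) := by
    induction k with
    | zero => exact hz₀
    | succ k ih => exact hg1 (a + k) _ ih
  have hd (k : ℕ) : z (k + 1) - z k ∈ m ^ (a + k) := hg2 (a + k) _ (hz k)
  have hd' (k j : ℕ) : z (k + j) - z k ∈ m ^ (a + k) := by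
    induction j with
    | zero => simp
    | succ j ih =>
      have := Ideal.pow_le_pow_right (by lia : a + k ≤ a + (k + j)) (hd (k + j))
      simpa [← add_assoc] using add_mem this ih
  obtain ⟨L, hL⟩ := IsPrecomplete.prec (I := m) inferInstance (f := z) (by
    intro i j hij
    obtain ⟨d, rfl⟩ := Nat.exists_eq_add_of_le hij
    rw [SModEq.comm, SModEq.sub_mem]
    simpa using Ideal.pow_le_pow_right (by lia) (hd' i d))
  have hL' (k : ℕ) : z k - L ∈ m ^ k := by simpa [SModEq.sub_mem] using hL k
  have hL0 : L = 0 := by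
    rw [← Ideal.mem_bot, ← hbot, Ideal.mem_iInf]
    intro n
    have h1 := hanti (by lia : n ≤ N (a + n) + (a + n)) (hz n)
    simpa using sub_mem h1 (hpow n (hL' n))
  refine hz₀a ?_
  have h1 := hL' a
  have h2 : z a - z 0 ∈ m ^ a := by simpa using hd' 0 a
  rw [hL0, sub_zero] at h1
  have h3 := sub_mem h1 h2
  rwa [sub_sub_cancel] at h3

theorem exists_valuationSubring_of_mem_minimalPrimes {K : Type u} [Field K] (S : Subring K)
    [IsNoetherianRing S] (x : S) (hx0 : x ≠ 0) (P : Ideal S)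
    (hP : P ∈ (Ideal.span {x}).minimalPrimes) :
    ∃ V : ValuationSubring K, S ≤ V.toSubring ∧ V.valuation (x : K) < 1 ∧
      ∀ s : S, (∀ n : ℕ, V.valuation (s : K) ≤ V.valuation (x : K) ^ n) → s = 0 := by
  have hPp : P.IsPrime := hP.1.1
  have hxP : x ∈ P := hP.1.2 (Ideal.mem_span_singleton_self x)
  have hx0' : (x : K) ≠ 0 := fun h => hx0 (Subtype.ext h)
  obtain ⟨V, hV⟩ := (LocalSubring.ofPrime S P).exists_le_valuationSubring
  have hSV : S ≤ V.toSubring := (LocalSubring.le_ofPrime S P).trans hV.1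
  have hlt : ∀ s : S, V.valuation (s : K) < 1 → s ∈ P := by
    intro s hs
    by_contra hsP
    have hu := IsLocalization.map_units (LocalSubring.ofPrime S P).toSubring
      (⟨s, hsP⟩ : P.primeCompl)
    obtain ⟨⟨b, hb⟩, e⟩ := isUnit_iff_exists_inv.mp hu
    have e' : (s : K) * b = 1 := congrArg Subtype.val e
    have hb1 : V.valuation b ≤ 1 := (V.valuation_le_one_iff b).mpr (hV.1 hb)
    have h1 : V.valuation (s : K) * V.valuation b = 1 := by rw [← map_mul, e', map_one]
    exact absurd h1 (mul_lt_one_of_lt_of_le hs hb1).ne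
  have hxlt : V.valuation (x : K) < 1 := by
    let x' : (LocalSubring.ofPrime S P).toSubring := algebraMap S _ x
    have hx' : x' ∈ maximalIdeal (LocalSubring.ofPrime S P).toSubring := by
      rw [← IsLocalization.AtPrime.map_eq_maximalIdeal P]
      exact Ideal.mem_map_of_mem _ hxP
    have h2 : (⟨x, hSV x.2⟩ : V) ∈ maximalIdeal V :=
      (mem_maximalIdeal _).mpr fun h => (mem_maximalIdeal _).mp hx' (hV.2.1 x' h)
    exact (V.valuation_lt_one_iff _).mp h2
  refine ⟨V, hSV, hxlt, ?_⟩
  have hS1 (s : S) : V.valuation (s : K) ≤ 1 := (V.valuation_le_one_iff _).mpr (hSV s.2)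
  let Q : Ideal S :=
    { carrier := {s | ∀ n : ℕ, V.valuation (s : K) ≤ V.valuation (x : K) ^ n}
      zero_mem' := fun n => by simp
      add_mem' := fun {a b} ha hb n => (V.valuation.map_add _ _).trans (max_le (ha n) (hb n))
      smul_mem' := fun c s hs n => by
        simpa using mul_le_of_le_one_of_le (hS1 c) (hs n) }
  have hQ (s : S) : s ∈ Q ↔ ∀ n : ℕ, V.valuation (s : K) ≤ V.valuation (x : K) ^ n := Iff.rfl
  have hxv : 0 < V.valuation (x : K) := by simpa [zero_lt_iff] using hx0'
  have hxQ : x ∉ Q := by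
    intro h
    have h2 := h 2
    rw [pow_two] at h2
    exact absurd h2 (not_le.mpr (mul_lt_of_lt_one_right hxv hxlt))
  have hQP : Q ≤ P := fun s hs => hlt s (lt_of_le_of_lt (by simpa using hs 1) hxlt)
  have hQprime : Q.IsPrime := by
    refine ⟨fun h => hxQ (h ▸ Submodule.mem_top), fun {a b} hab => ?_⟩
    by_contra! hcon
    simp only [hQ, not_forall, not_le] at hcon
    obtain ⟨⟨i, hi⟩, ⟨j, hj⟩⟩ := hcon
    have := hab (i + j)
    rw [Subring.coe_mul, map_mul, pow_add] at this
    exact absurd this (not_le.mpr (mul_lt_mul'' hi hj zero_le zero_le))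
  have hht : P.height ≤ 1 := Ideal.height_le_one_of_isPrincipal_of_mem_minimalPrimes _ P hP
  have hQ0 : Q = ⊥ := by
    by_contra hne
    have h1 : Q < P := lt_of_le_of_ne hQP fun h => hxQ (h ▸ hxP)
    have h2 := (Ideal.height_add_one_le_of_lt_of_isPrime h1).trans hht
    refine hne (Ideal.height_eq_zero_iff_eq_bot.mp ?_)
    have h3 : Q.height + 1 ≤ 0 + 1 := by rw [zero_add]; exact h2
    exact le_zero_iff.mp ((ENat.add_le_add_iff_right ENat.one_ne_top).mp h3)
  intro s hs
  have : s ∈ Q := hs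
  rwa [hQ0] at this

theorem exists_valuation_iInf_eq_bot (C : Type u) [CommRing C] [IsDomain C] [IsLocalRing C]
    [IsNoetherianRing C] (hC : maximalIdeal C ≠ ⊥) :
    ∃ (V : ValuationSubring (FractionRing C)) (x : C), V.valuation (algebraMap C _ x) < 1 ∧
      (∀ c : C, V.valuation (algebraMap C _ c) ≤ 1) ∧
      (∀ c ∈ maximalIdeal C, V.valuation (algebraMap C _ c) ≤ V.valuation (algebraMap C _ x)) ∧
      ∀ c : C, (∀ n : ℕ, V.valuation (algebraMap C _ c) ≤ V.valuation (algebraMap C _ x) ^ n) →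
        c = 0 := by
  classical
  let K := FractionRing C
  let ι : C →+* K := algebraMap C K
  have hι : Function.Injective ι := IsFractionRing.injective C K
  obtain ⟨s, hs⟩ : (maximalIdeal C).FG := IsNoetherian.noetherian _
  obtain ⟨V₀, hV₀, hmV₀⟩ :=
    (((maximalIdeal C).map ι.rangeRestrict) : Ideal ι.range).image_subset_nonunits_valuationSubring
      (by
        intro h
        have h1 := congrArg (Ideal.comap ι.rangeRestrict) h
        rw [Ideal.comap_map_of_bijective _ ⟨fun a b hab => hι (congrArg Subtype.val hab),
          ι.rangeRestrict_surjective⟩, Ideal.comap_top] at h1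
        exact (maximalIdeal.isMaximal C).ne_top h1)
  have hsne : s.Nonempty := by
    rw [Finset.nonempty_iff_ne_empty]
    rintro rfl
    exact hC (by simpa using hs.symm)
  obtain ⟨x, hxs, hx⟩ := s.exists_max_image (fun g => V₀.valuation (ι g)) hsne
  have hx0 : x ≠ 0 := by
    rintro rfl
    refine hC (hs ▸ ?_)
    rw [Ideal.span_eq_bot]
    intro g hg
    have := hx g hg
    simp only [map_zero, le_zero_iff, map_eq_zero] at this
    exact (map_eq_zero_iff ι hι).mp this
  have hιx : ι x ≠ 0 := fun h => hx0 ((map_eq_zero_iff ι hι).mp h)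
  have hxm : x ∈ maximalIdeal C := hs ▸ Ideal.subset_span hxs
  have hxV₀ : V₀.valuation (ι x) < 1 := by
    have := hmV₀ ⟨_, Ideal.mem_map_of_mem ι.rangeRestrict hxm, rfl⟩
    exact V₀.mem_nonunits_iff.mp this
  let t : Finset K := s.image fun g => ι g / ι x
  let S' : Subalgebra C K := Algebra.adjoin C (t : Set K)
  have hfg : S'.FG := ⟨t, rfl⟩
  have : Algebra.FiniteType C S' := S'.fg_iff_finiteType.mp hfg
  have hN : IsNoetherianRing S' := Algebra.FiniteType.isNoetherianRing C S'
  let S : Subring K := S'.toSubring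
  have : IsNoetherianRing S := hN
  have hιS (c : C) : ι c ∈ S := S'.algebraMap_mem c
  have hSV₀ : ∀ y ∈ S, V₀.valuation y ≤ 1 := by
    intro y (hy : y ∈ S')
    rw [V₀.valuation_le_one_iff]
    induction hy using Algebra.adjoin_induction with
    | mem y hy =>
      obtain ⟨g, hg, rfl⟩ := Finset.mem_image.mp (Finset.mem_coe.mp hy)
      rw [← V₀.valuation_le_one_iff, map_div₀]
      exact div_le_one_of_le₀ (hx g hg) zero_le
    | algebraMap c => exact hV₀ ⟨c, rfl⟩
    | add _ _ _ _ h1 h2 => exact V₀.add_mem _ _ h1 h2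
    | mul _ _ _ _ h1 h2 => exact V₀.mul_mem _ _ h1 h2
  let X : S := ⟨ι x, hιS x⟩
  have hXtop : Ideal.span {X} ≠ ⊤ := by
    rw [Ne, Ideal.span_singleton_eq_top, isUnit_iff_exists_inv]
    rintro ⟨b, hb⟩
    have h1 : V₀.valuation (ι x) * V₀.valuation (b : K) = 1 := by
      rw [← map_mul, show ι x * (b : K) = 1 from congrArg Subtype.val hb, map_one]
    exact absurd h1 (mul_lt_one_of_lt_of_le hxV₀ (hSV₀ _ b.2)).ne
  obtain ⟨P, hP⟩ := Ideal.nonempty_minimalPrimes hXtop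
  obtain ⟨V, hSV, hXV, hV⟩ := exists_valuationSubring_of_mem_minimalPrimes S X
    (fun h => hιx (congrArg Subtype.val h)) P hP
  have hS1 : ∀ y ∈ S, V.valuation y ≤ 1 := fun y hy => (V.valuation_le_one_iff y).mpr (hSV hy)
  refine ⟨V, x, hXV, fun c => hS1 _ (hιS c), fun c hc => ?_, fun c hc => ?_⟩
  · rw [← hs] at hc
    change V.valuation (ι c) ≤ V.valuation (ι x)
    induction hc using Submodule.span_induction with
    | mem g hg =>
      have : ι g = ι g / ι x * ι x := (div_mul_cancel₀ _ hιx).symm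
      rw [this, map_mul]
      exact mul_le_of_le_one_left zero_le
        (hS1 _ (Algebra.subset_adjoin (Finset.mem_coe.mpr (Finset.mem_image_of_mem _ hg))))
    | zero => simp
    | add a b _ _ h1 h2 => rw [map_add]; exact (V.valuation.map_add _ _).trans (max_le h1 h2)
    | smul a b _ h =>
      rw [smul_eq_mul, map_mul, map_mul]
      exact mul_le_of_le_one_of_le (hS1 _ (hιS a)) h
  · exact (map_eq_zero_iff ι hι).mp (congrArg Subtype.val (hV ⟨ι c, hιS c⟩ hc))

theorem exists_forall_mul_mem_maximalIdeal_pow (C : Type u) [CommRing C] [IsDomain C]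
    [IsLocalRing C] [IsNoetherianRing C] [IsAdicComplete (maximalIdeal C) C] (a : ℕ) :
    ∃ c, ∀ x y : C, x * y ∈ maximalIdeal C ^ c →
      x ∈ maximalIdeal C ^ a ∨ y ∈ maximalIdeal C ^ a := by
  by_cases hC : maximalIdeal C = ⊥
  · refine ⟨1, fun x y h => ?_⟩
    rw [hC, pow_one, Ideal.mem_bot, mul_eq_zero] at h
    rcases h with rfl | rfl
    exacts [Or.inl (zero_mem _), Or.inr (zero_mem _)]
  obtain ⟨V, t, ht1, hle1, hmt, hzero⟩ := exists_valuation_iInf_eq_bot C hC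
  let w : Valuation C V.ValueGroup := V.valuation.comap (algebraMap C (FractionRing C))
  change w t < 1 at ht1
  change ∀ c, w c ≤ 1 at hle1
  change ∀ c ∈ maximalIdeal C, w c ≤ w t at hmt
  change ∀ c, (∀ n : ℕ, w c ≤ w t ^ n) → c = 0 at hzero
  let I (n : ℕ) : Ideal C :=
    { carrier := {c | w c ≤ w t ^ n}
      zero_mem' := by simp
      add_mem' := fun {a b} ha hb => (w.map_add _ _).trans (max_le ha hb)
      smul_mem' := fun c s hs => by
        simpa using mul_le_of_le_one_of_le (hle1 c) hs }
  have hI (n : ℕ) (c : C) : c ∈ I n ↔ w c ≤ w t ^ n := Iff.rfl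
  have hanti : Antitone I := fun i j hij c hc =>
    (show w c ≤ w t ^ j from hc).trans (pow_le_pow_right_of_le_one' ht1.le hij)
  have hbot : ⨅ n, I n = ⊥ := by
    rw [eq_bot_iff]
    intro c hc
    exact hzero c fun n => (Ideal.mem_iInf.mp hc n)
  have hpow (n : ℕ) : maximalIdeal C ^ n ≤ I n := by
    induction n with
    | zero => intro c _; simpa [hI] using hle1 c
    | succ n ih =>
      rw [pow_succ, Ideal.mul_le]
      intro r hr s hs
      rw [hI, map_mul, pow_succ]
      exact mul_le_mul' (ih hr) (hmt s hs)
  obtain ⟨n, hn⟩ := exists_pow_le_of_iInf_eq_bot C I hanti hbot hpow a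
  refine ⟨n + n, fun x y hxy => ?_⟩
  by_contra! hcon
  have hx : w t ^ n < w x := not_le.mp fun h => hcon.1 (hn h)
  have hy : w t ^ n < w y := not_le.mp fun h => hcon.2 (hn h)
  have h := hpow _ hxy
  rw [hI, map_mul, pow_add] at h
  exact absurd h (not_le.mpr (mul_lt_mul'' hx hy zero_le zero_le))

theorem exists_forall_mul_mem_of_isDomain_adicCompletion (R : Type u) [CommRing R]
    [IsLocalRing R] [IsNoetherianRing R] [IsDomain (AdicCompletion (maximalIdeal R) R)] (a : ℕ) :
    ∃ c, ∀ x y : R, x * y ∈ maximalIdeal R ^ c →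
      x ∈ maximalIdeal R ^ a ∨ y ∈ maximalIdeal R ^ a := by
  have := adicCompletion_isNoetherianRing R (maximalIdeal R)
  have hmax : maximalIdeal (AdicCompletion (maximalIdeal R) R) =
      (maximalIdeal R).map (algebraMap R (AdicCompletion (maximalIdeal R) R)) :=
    AdicCompletion.maximalIdeal_eq_map ..
  obtain ⟨c, hc⟩ :=
    exists_forall_mul_mem_maximalIdeal_pow (AdicCompletion (maximalIdeal R) R) a
  have key (x : R) (h : algebraMap R (AdicCompletion (maximalIdeal R) R) x ∈
      maximalIdeal (AdicCompletion (maximalIdeal R) R) ^ a) : x ∈ maximalIdeal R ^ a := by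
    rw [hmax, ← Ideal.map_pow] at h
    have hle : (maximalIdeal R ^ a).map (algebraMap R (AdicCompletion (maximalIdeal R) R)) ≤
        RingHom.ker (AdicCompletion.evalₐ (maximalIdeal R) a) := by
      rw [Ideal.map_le_iff_le_comap]
      intro z hz
      rw [Ideal.mem_comap, RingHom.mem_ker, AlgHom.commutes]
      exact Ideal.Quotient.eq_zero_iff_mem.mpr hz
    have h1 := hle h
    rw [RingHom.mem_ker, AlgHom.commutes] at h1
    exact Ideal.Quotient.eq_zero_iff_mem.mp h1
  refine ⟨c, fun x y hxy => ?_⟩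
  refine (hc (algebraMap R _ x) (algebraMap R _ y) ?_).imp (key x) (key y)
  rw [← map_mul, hmax, ← Ideal.map_pow]
  exact Ideal.mem_map_of_mem _ hxy

theorem isDomain_adicCompletion_of_forall_mul_mem (R : Type u) [CommRing R] [IsLocalRing R]
    (h : ∀ a, ∃ c, ∀ x y : R, x * y ∈ maximalIdeal R ^ c →
      x ∈ maximalIdeal R ^ a ∨ y ∈ maximalIdeal R ^ a) :
    IsDomain (AdicCompletion (maximalIdeal R) R) := by
  have hone : (1 : R) ∉ maximalIdeal R ^ 1 := by
    rw [pow_one]; exact (Ideal.ne_top_iff_one _).mp (maximalIdeal.isMaximal R).ne_top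
  have : Nontrivial (AdicCompletion (maximalIdeal R) R) := by
    refine ⟨⟨0, 1, fun he => hone ?_⟩⟩
    have h1 := congrArg (AdicCompletion.evalₐ (maximalIdeal R) 1) he
    rw [map_zero, map_one] at h1
    exact Ideal.Quotient.eq_zero_iff_mem.mp h1.symm
  have : NoZeroDivisors (AdicCompletion (maximalIdeal R) R) := by
    refine ⟨fun {p q} hpq => ?_⟩
    obtain ⟨f, rfl⟩ : ∃ f, AdicCompletion.mkₐ (maximalIdeal R) f = p :=
      AdicCompletion.mk_surjective _ _ p
    obtain ⟨g, rfl⟩ : ∃ g, AdicCompletion.mkₐ (maximalIdeal R) g = q :=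
      AdicCompletion.mk_surjective _ _ q
    have hzero (r : AdicCompletion.AdicCauchySequence (maximalIdeal R) R)
        (hr : ∀ n, r.val n ∈ maximalIdeal R ^ n) : AdicCompletion.mkₐ (maximalIdeal R) r = 0 := by
      refine AdicCompletion.ext_evalₐ fun n => ?_
      rw [AdicCompletion.evalₐ_mkₐ, map_zero]
      exact Ideal.Quotient.eq_zero_iff_mem.mpr (hr n)
    have hstep (r : AdicCompletion.AdicCauchySequence (maximalIdeal R) R) {m n : ℕ} (hmn : m ≤ n)
        (hr : r.val n ∈ maximalIdeal R ^ m) : r.val m ∈ maximalIdeal R ^ m := by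
      exact Ideal.Quotient.eq_zero_iff_mem.mp
        ((AdicCompletion.Ideal.mk_eq_mk (maximalIdeal R) hmn r).symm.trans (Ideal.Quotient.eq_zero_iff_mem.mpr hr))
    by_contra! hcon
    obtain ⟨i, hi⟩ : ∃ n, f.val n ∉ maximalIdeal R ^ n := by
      by_contra! hf
      exact hcon.1 (hzero f hf)
    obtain ⟨j, hj⟩ : ∃ n, g.val n ∉ maximalIdeal R ^ n := by
      by_contra! hg
      exact hcon.2 (hzero g hg)
    obtain ⟨c, hc⟩ := h (max i j)
    let N := max c (max i j)
    have hN : f.val N * g.val N ∈ maximalIdeal R ^ N := by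
      have h1 := congrArg (AdicCompletion.evalₐ (maximalIdeal R) N) hpq
      rw [map_mul, AdicCompletion.evalₐ_mkₐ, AdicCompletion.evalₐ_mkₐ, map_zero, ← map_mul] at h1
      exact Ideal.Quotient.eq_zero_iff_mem.mp h1
    rcases hc _ _ (Ideal.pow_le_pow_right (le_max_left _ _) hN) with hf | hg
    · exact hi (hstep f (show i ≤ N by omega) (Ideal.pow_le_pow_right (le_max_left i j) hf))
    · exact hj (hstep g (show j ≤ N by omega) (Ideal.pow_le_pow_right (le_max_right i j) hg))
  exact NoZeroDivisors.to_isDomain _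

theorem bounded_multiplication_iff (R : Type u) [CommRing R] [IsLocalRing R]
    [IsNoetherianRing R] :
    (∃ μ : ℕ → ℕ → ℕ, ∀ x y : R, x ≠ 0 → y ≠ 0 →
        x * y ≠ 0 ∧ ordR R (x * y) ≤ μ (ordR R x) (ordR R y)) ↔
    ∀ a, ∃ c, ∀ x y : R, x * y ∈ maximalIdeal R ^ c →
      x ∈ maximalIdeal R ^ a ∨ y ∈ maximalIdeal R ^ a := by
  have hbdd (x : R) (hx : x ≠ 0) : ∃ n, x ∉ maximalIdeal R ^ n := by
    by_contra! hcon
    apply hx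
    rw [← Ideal.mem_bot, ← Ideal.iInf_pow_eq_bot_of_isLocalRing (maximalIdeal R)
      (maximalIdeal.isMaximal R).ne_top]
    exact Ideal.mem_iInf.mpr hcon
  have hlt (x : R) (n : ℕ) (hn : x ∉ maximalIdeal R ^ n) : ordR R x < n := by
    have hb : ∀ k ∈ {k : ℕ | x ∈ maximalIdeal R ^ k}, k < n := fun k hk =>
      not_le.mp fun hle => hn (Ideal.pow_le_pow_right hle hk)
    exact hb _ (Nat.sSup_mem ⟨0, by simp⟩ ⟨n, fun k hk => (hb k hk).le⟩)
  have hnot (x : R) (hx : x ≠ 0) (n : ℕ) (hn : ordR R x < n) : x ∉ maximalIdeal R ^ n := by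
    intro h
    obtain ⟨N, hN⟩ := hbdd x hx
    refine absurd (le_csSup ⟨N, fun k hk => ?_⟩ h) (not_le.mpr hn)
    exact (not_le.mp fun hle => hN (Ideal.pow_le_pow_right hle hk)).le
  constructor
  · rintro ⟨μ, hμ⟩ a
    let s := (Finset.range a ×ˢ Finset.range a).sup fun p => μ p.1 p.2
    refine ⟨s + 1, fun x y hxy => ?_⟩
    by_contra! hcon
    have hx0 : x ≠ 0 := by rintro rfl; exact hcon.1 (zero_mem _)
    have hy0 : y ≠ 0 := by rintro rfl; exact hcon.2 (zero_mem _)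
    obtain ⟨h0, hle⟩ := hμ x y hx0 hy0
    have hs : μ (ordR R x) (ordR R y) ≤ s :=
      Finset.le_sup (f := fun p : ℕ × ℕ => μ p.1 p.2) (b := (ordR R x, ordR R y))
        (by simp [hlt x a hcon.1, hlt y a hcon.2])
    exact hnot _ h0 (s + 1) (by omega) hxy
  · intro h
    choose c hc using h
    refine ⟨fun i j => c (max i j + 1), fun x y hx hy => ?_⟩
    have hn : x * y ∉ maximalIdeal R ^ c (max (ordR R x) (ordR R y) + 1) := fun hxy =>
      (hc _ x y hxy).elim (hnot x hx _ (by omega)) (hnot y hy _ (by omega))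
    exact ⟨fun h0 => hn (h0 ▸ zero_mem _), (hlt _ _ hn).le⟩

theorem mk_mem_map_ultraDiag_iff {R : Type u} [CommRing R] (u : Ultrafilter ℕ) (I : Ideal R)
    (hI : I.FG) (f : ℕ → R) :
    Ideal.Quotient.mk (ultraZeroIdeal u R) f ∈ I.map (ultraDiag u R) ↔
      ∀ᶠ w in (u : Filter ℕ), f w ∈ I := by
  constructor
  · intro h
    let J : Ideal (ℕ → R) :=
      { carrier := {f | ∀ᶠ w in (u : Filter ℕ), f w ∈ I}
        zero_mem' := Eventually.of_forall fun _ => I.zero_mem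
        add_mem' := fun {a b} ha hb => by
          filter_upwards [ha, hb] with w h1 h2 using I.add_mem h1 h2
        smul_mem' := fun c f hf => by
          filter_upwards [hf] with w h1 using I.mul_mem_left _ h1 }
    have hle : I.map (ultraDiag u R) ≤ J.map (Ideal.Quotient.mk (ultraZeroIdeal u R)) := by
      rw [Ideal.map_le_iff_le_comap]
      intro x hx
      exact Ideal.mem_map_of_mem (Ideal.Quotient.mk (ultraZeroIdeal u R))
        (show Pi.constRingHom ℕ R x ∈ J from Eventually.of_forall fun _ => hx)
    obtain ⟨g, hg, hfg⟩ :=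
      (Ideal.mem_map_iff_of_surjective _ Ideal.Quotient.mk_surjective).mp (hle h)
    have h1 : ∀ᶠ w in (u : Filter ℕ), (g - f) w = 0 := Ideal.Quotient.eq.mp hfg
    have hg' : ∀ᶠ w in (u : Filter ℕ), g w ∈ I := hg
    filter_upwards [h1, hg'] with w h2 h3
    rw [Pi.sub_apply, sub_eq_zero] at h2
    rwa [← h2]
  · intro h
    obtain ⟨s, rfl⟩ := hI
    have hex (w : ℕ) : ∃ k : R → R, f w ∈ Ideal.span (s : Set R) →
        f w = ∑ i ∈ s, k i * i := by
      by_cases hw : f w ∈ Ideal.span (s : Set R)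
      · obtain ⟨k, -, hk⟩ := Submodule.mem_span_finset.mp hw
        exact ⟨k, fun _ => hk.symm⟩
      · exact ⟨0, fun h => absurd h hw⟩
    choose k hk using hex
    have hsum : Ideal.Quotient.mk (ultraZeroIdeal u R) f =
        ∑ i ∈ s, Ideal.Quotient.mk (ultraZeroIdeal u R) (fun w => k w i) * ultraDiag u R i := by
      simp only [ultraDiag, RingHom.comp_apply, ← map_mul, ← map_sum]
      refine Ideal.Quotient.eq.mpr ?_
      change ∀ᶠ w in (u : Filter ℕ), _ = 0
      filter_upwards [h] with w hw
      simp [hk w hw]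
    rw [hsum]
    exact Ideal.sum_mem _ fun i hi => Ideal.mul_mem_left _ _
      (Ideal.mem_map_of_mem _ (Ideal.subset_span hi))

theorem mk_mem_iInf_map_ultraDiag_iff {R : Type u} [CommRing R] [IsLocalRing R]
    [IsNoetherianRing R] (u : Ultrafilter ℕ) (f : ℕ → R) :
    Ideal.Quotient.mk (ultraZeroIdeal u R) f ∈
        (⨅ n : ℕ, Ideal.map (ultraDiag u R) (maximalIdeal R ^ n)) ↔
      ∀ n, ∀ᶠ w in (u : Filter ℕ), f w ∈ maximalIdeal R ^ n := by
  rw [Ideal.mem_iInf]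
  exact forall_congr' fun n => mk_mem_map_ultraDiag_iff u _ (IsNoetherian.noetherian _) f

theorem isDomain_catapower_iff {R : Type u} [CommRing R] [IsLocalRing R]
    [IsNoetherianRing R] (u : Ultrafilter ℕ) (hu : ∀ a : ℕ, (u : Filter ℕ) ≠ pure a) :
    IsDomain (Catapower u R) ↔
      ∀ a, ∃ c, ∀ x y : R, x * y ∈ maximalIdeal R ^ c →
        x ∈ maximalIdeal R ^ a ∨ y ∈ maximalIdeal R ^ a := by
  have hone : (1 : R) ∉ maximalIdeal R ^ 1 := by
    rw [pow_one]; exact (Ideal.ne_top_iff_one _).mp (maximalIdeal.isMaximal R).ne_top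
  rw [Ideal.Quotient.isDomain_iff_prime]
  constructor
  · intro hp a
    by_contra! hcon
    choose x y hxy hx hy using hcon
    have hge (n : ℕ) : ∀ᶠ w in (u : Filter ℕ), n ≤ w := by
      have : (u : Filter ℕ) ≤ cofinite := by
        rcases u.le_cofinite_or_eq_pure with h | ⟨b, rfl⟩
        · exact h
        · exact absurd rfl (hu b)
      rw [Nat.cofinite_eq_atTop] at this
      exact this (eventually_ge_atTop n)
    have hmem : Ideal.Quotient.mk (ultraZeroIdeal u R) x *
        Ideal.Quotient.mk (ultraZeroIdeal u R) y ∈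
        (⨅ n : ℕ, Ideal.map (ultraDiag u R) (maximalIdeal R ^ n)) := by
      rw [← map_mul, mk_mem_iInf_map_ultraDiag_iff]
      intro n
      filter_upwards [hge n] with w hw using Ideal.pow_le_pow_right hw (hxy w)
    rcases hp.mem_or_mem hmem with h | h
    · obtain ⟨w, hw⟩ := ((mk_mem_iInf_map_ultraDiag_iff u x).mp h a).exists
      exact hx w hw
    · obtain ⟨w, hw⟩ := ((mk_mem_iInf_map_ultraDiag_iff u y).mp h a).exists
      exact hy w hw
  · intro h
    refine ⟨fun htop => ?_, fun {p q} hpq => ?_⟩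
    · have h1 := (mk_mem_iInf_map_ultraDiag_iff u (1 : ℕ → R)).mp (htop ▸ Submodule.mem_top) 1
      obtain ⟨w, hw⟩ := h1.exists
      exact hone hw
    · obtain ⟨f, rfl⟩ := Ideal.Quotient.mk_surjective p
      obtain ⟨g, rfl⟩ := Ideal.Quotient.mk_surjective q
      rw [← map_mul, mk_mem_iInf_map_ultraDiag_iff] at hpq
      rw [mk_mem_iInf_map_ultraDiag_iff, mk_mem_iInf_map_ultraDiag_iff]
      by_contra! hcon
      obtain ⟨⟨i, hi⟩, j, hj⟩ := hcon
      obtain ⟨c, hc⟩ := h (max i j)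
      obtain ⟨w, hw, hiw, hjw⟩ := ((hpq c).and (hi.and hj)).exists
      exact (hc _ _ hw).elim
        (fun h => hiw (Ideal.pow_le_pow_right (le_max_left i j) h))
        (fun h => hjw (Ideal.pow_le_pow_right (le_max_right i j) h))

set_option synthInstance.maxHeartbeats 1000000 in
set_option maxHeartbeats 2000000 in
theorem analytically_irreducible_tfae
    (R : Type u) [CommRing R] [IsLocalRing R] [IsNoetherianRing R] :
    (IsDomain (AdicCompletion (IsLocalRing.maximalIdeal R) R) ↔
      ∃ μ : ℕ → ℕ → ℕ, ∀ x y : R, x ≠ 0 → y ≠ 0 →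
        x * y ≠ 0 ∧ ordR R (x * y) ≤ μ (ordR R x) (ordR R y)) ∧
    (IsDomain (AdicCompletion (IsLocalRing.maximalIdeal R) R) ↔
      ∀ u : Ultrafilter ℕ, (∀ a : ℕ, (u : Filter ℕ) ≠ pure a) →
        IsDomain (Catapower u R)) ∧
    (IsDomain (AdicCompletion (IsLocalRing.maximalIdeal R) R) ↔
      ∃ u : Ultrafilter ℕ, (∀ a : ℕ, (u : Filter ℕ) ≠ pure a) ∧
        IsDomain (Catapower u R)) := by
  have hiff : IsDomain (AdicCompletion (maximalIdeal R) R) ↔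
      ∀ a, ∃ c, ∀ x y : R, x * y ∈ maximalIdeal R ^ c →
        x ∈ maximalIdeal R ^ a ∨ y ∈ maximalIdeal R ^ a :=
    ⟨fun _ => exists_forall_mul_mem_of_isDomain_adicCompletion R,
      isDomain_adicCompletion_of_forall_mul_mem R⟩
  have hyper (a : ℕ) : ((hyperfilter ℕ : Ultrafilter ℕ) : Filter ℕ) ≠ pure a := by
    intro h
    have h1 : ({a}ᶜ : Set ℕ) ∈ ((hyperfilter ℕ : Ultrafilter ℕ) : Filter ℕ) :=
      hyperfilter_le_cofinite (Set.finite_singleton a).compl_mem_cofinite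
    rw [h] at h1
    exact h1 rfl
  refine ⟨hiff.trans (bounded_multiplication_iff R).symm,
    hiff.trans ⟨fun h u hu => (isDomain_catapower_iff u hu).mpr h,
      fun h => (isDomain_catapower_iff _ hyper).mp (h _ hyper)⟩,
    hiff.trans ⟨fun h => ⟨_, hyper, (isDomain_catapower_iff _ hyper).mpr h⟩, ?_⟩⟩
  rintro ⟨u, hu, h⟩
  exact (isDomain_catapower_iff u hu).mp h
end

section
/- A Noetherian local ring (R, m) is analytically unramified (i.e., its m-adic completion R̂ is reduced) if and only if there exists a function ν : ℕ → ℕ such that for every nonzero x ∈ R one has ord(x²) ≤ ν(ord(x)); in particular, in this case x² ≠ 0 for every nonzero x. -/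
/-!
STATEMENT 14: A Noetherian local ring `(R, m)` is analytically unramified (its `m`-adic
completion is reduced) iff there is a function `ν : ℕ → ℕ` such that for every nonzero
`x ∈ R` one has `ord(x²) ≤ ν(ord x)`; in particular `x² ≠ 0` for every nonzero `x`.
Here `ord x` is the largest `n` with `x ∈ m^n`.
-/

universe u

open IsLocalRing
open scoped LaurentPolynomial

theorem AdicCompletion.isNoetherianRing {R : Type*} [CommRing R] [IsNoetherianRing R]
    (I : Ideal R) : IsNoetherianRing (AdicCompletion I R) := by
  obtain ⟨n, a, ha⟩ := Submodule.fg_iff_exists_fin_generating_family.mp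
    I.fg_of_isNoetherianRing
  let S := MvPolynomial (Fin n) R
  let J : Ideal S := MvPolynomial.idealOfVars (Fin n) R
  have hJ : J.FG := MvPolynomial.idealOfVars_fg (Fin n) R
  let φ : S →+* R := MvPolynomial.eval a
  have hmap : J.map φ = I := by
    rw [← ha]
    simp only [J, MvPolynomial.idealOfVars, Ideal.map_span, ← Set.range_comp]
    congr 2
    ext i
    exact MvPolynomial.eval_X i
  have hpow (k : ℕ) : J ^ k ≤ (I ^ k).comap φ := by
    rw [← Ideal.map_le_iff_le_comap, Ideal.map_pow, hmap]
  let F : AdicCompletion J S →+* AdicCompletion I R :=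
    AdicCompletion.liftRingHom I
      (fun k ↦ (Ideal.quotientMap (I ^ k) φ (hpow k)).comp (evalₐ J k).toRingHom) (by
        intro k l hkl
        ext x
        obtain ⟨x, rfl⟩ := AdicCompletion.mk_surjective _ _ x
        simp [Ideal.quotientMap_mk]
        rw [Ideal.Quotient.eq, ← map_sub]
        apply hpow k
        rw [← Ideal.Quotient.eq]
        exact (AdicCompletion.Ideal.mk_eq_mk _ hkl x))
  have hF (s : S) : F (algebraMap S _ s) = algebraMap R _ (φ s) := by
    refine AdicCompletion.ext_evalₐ fun k ↦
      (AdicCompletion.evalₐ_liftRingHom _ _ _ k _).trans ?_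
    simp
  have hFmap : (J.map (algebraMap S (AdicCompletion J S))).map F =
      I.map (algebraMap R (AdicCompletion I R)) := by
    rw [Ideal.map_map, RingHom.ext (f := F.comp _) (g := (algebraMap R _).comp φ) hF,
      ← Ideal.map_map, hmap]
  have := AdicCompletion.isAdicComplete_self J hJ
  have := AdicCompletion.isAdicComplete_self I I.fg_of_isNoetherianRing
  have hsurj : Function.Surjective F := by
    refine surjective_of_mk_map_comp_surjective (I := J.map (algebraMap S (AdicCompletion J S)))
      (haus := by rw [hFmap]; infer_instance) F ?_
    intro y
    obtain ⟨y, rfl⟩ := Ideal.Quotient.mk_surjective y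
    obtain ⟨r, hr⟩ := Ideal.Quotient.mk_surjective (evalOneₐ I y)
    refine ⟨algebraMap S _ (MvPolynomial.C r), ?_⟩
    rw [RingHom.comp_apply, Ideal.Quotient.eq, hF, hFmap,
      ← AdicCompletion.ker_evalOneₐ_eq_map I I.fg_of_isNoetherianRing, RingHom.mem_ker]
    rw [map_sub, sub_eq_zero, show φ (MvPolynomial.C r) = r from MvPolynomial.eval_C r]
    exact hr
  have : IsNoetherianRing (AdicCompletion J S) := isNoetherianRing_of_ringEquiv _
    (MvPowerSeries.toAdicCompletionAlgEquiv (Fin n) R).toRingEquiv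
  exact isNoetherianRing_of_surjective _ _ F hsurj

theorem Ideal.iInf_sup_maximalIdeal_pow {A : Type*} [CommRing A] [IsLocalRing A]
    [IsNoetherianRing A] (K : Ideal A) : ⨅ i : ℕ, K ⊔ maximalIdeal A ^ i = K := by
  refine le_antisymm (fun x hx ↦ ?_) (le_iInf fun i ↦ le_sup_left)
  rw [← Ideal.Quotient.eq_zero_iff_mem]
  refine IsHausdorff.haus (inferInstance : IsHausdorff (maximalIdeal A) (A ⧸ K)) _ fun i ↦ ?_
  rw [SModEq.zero]
  obtain ⟨a, ha, b, hb, rfl⟩ := Submodule.mem_sup.mp ((Ideal.mem_iInf.mp hx) i)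
  rw [map_add, Ideal.Quotient.eq_zero_iff_mem.mpr ha, zero_add]
  simpa [Algebra.smul_def] using Submodule.smul_mem_smul hb (Submodule.mem_top (x := (1 : A ⧸ K)))

theorem IsLocalRing.isArtinianRing_quotient_maximalIdeal_pow (A : Type*) [CommRing A]
    [IsLocalRing A] [IsNoetherianRing A] (n : ℕ) : IsArtinianRing (A ⧸ maximalIdeal A ^ n) := by
  rcases eq_or_ne n 0 with rfl | hn
  · rw [pow_zero, Ideal.one_eq_top]
    infer_instance
  · refine quotient_artinian_of_mem_minimalPrimes_of_isLocalRing _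
      ⟨⟨inferInstance, Ideal.pow_le_self hn⟩, fun p hp _ ↦ ?_⟩
    have := hp.1
    exact Ideal.IsPrime.le_of_pow_le hp.2

theorem Ideal.exists_forall_le_sup_maximalIdeal_pow {A : Type*} [CommRing A] [IsLocalRing A]
    [IsNoetherianRing A] {K : ℕ → Ideal A} (hK : Antitone K) (j : ℕ) :
    ∃ k, ∀ l, K k ≤ K l ⊔ maximalIdeal A ^ j := by
  have := isArtinianRing_quotient_maximalIdeal_pow A j
  let π := Ideal.Quotient.mk (maximalIdeal A ^ j)
  obtain ⟨k, hk⟩ := IsArtinian.monotone_stabilizes (R := A ⧸ maximalIdeal A ^ j)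
    (M := A ⧸ maximalIdeal A ^ j)
    ⟨fun i ↦ OrderDual.toDual ((K i).map π), fun _ _ h ↦ Ideal.map_mono (hK h)⟩
  refine ⟨k, fun l ↦ ?_⟩
  rcases le_total k l with h | h
  · have h1 : (K k).map π = (K l).map π := hk l h
    have h2 := Ideal.le_comap_map (f := π) (I := K k)
    rwa [h1, Ideal.comap_map_of_surjective' _ Ideal.Quotient.mk_surjective, Ideal.mk_ker] at h2
  · exact (hK h).trans le_sup_left

/-- **Chevalley's theorem** on descending sequences of ideals in a complete Noetherian local
ring. -/
theorem Ideal.exists_le_maximalIdeal_pow_of_iInf_eq_bot {A : Type*} [CommRing A] [IsLocalRing A]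
    [IsNoetherianRing A] [IsAdicComplete (maximalIdeal A) A] {K : ℕ → Ideal A} (hK : Antitone K)
    (hbot : ⨅ k, K k = ⊥) (n : ℕ) : ∃ k, K k ≤ maximalIdeal A ^ n := by
  set m := maximalIdeal A
  choose κ hκ using Ideal.exists_forall_le_sup_maximalIdeal_pow hK
  refine ⟨κ n, fun x hx ↦ ?_⟩
  have step (j : ℕ) (y : A) (hy : ∀ l, y ∈ K l ⊔ m ^ j) :
      ∃ y', (∀ l, y' ∈ K l ⊔ m ^ (j + 1)) ∧ y' - y ∈ m ^ j := by
    obtain ⟨a, ha, b, hb, rfl⟩ := Submodule.mem_sup.mp (hy (κ (j + 1)))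
    exact ⟨a, fun l ↦ hκ _ l ha, by simpa using hb⟩
  choose! next hnext hsub using step
  let y : ℕ → A := fun i ↦ Nat.rec x (fun i z ↦ next (n + i) z) i
  have hy (i : ℕ) : ∀ l, y i ∈ K l ⊔ m ^ (n + i) := by
    induction i with
    | zero => exact fun l ↦ hκ n l hx
    | succ i ih => exact hnext _ _ ih
  have hmono (i d : ℕ) : y (i + d) - y i ∈ m ^ (n + i) := by
    induction d with
    | zero => simp
    | succ d ih =>
      rw [← sub_add_sub_cancel]
      exact add_mem (Ideal.pow_le_pow_right (by lia) (hsub _ _ (hy (i + d)))) ih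
  obtain ⟨L, hL⟩ := IsPrecomplete.prec (inferInstance : IsPrecomplete m A) (f := y) (by
    intro i j hij
    obtain ⟨d, rfl⟩ := Nat.exists_eq_add_of_le hij
    rw [SModEq.comm, SModEq.sub_mem, smul_eq_mul, Ideal.mul_top]
    exact Ideal.pow_le_pow_right (by lia) (hmono i d))
  simp only [SModEq.sub_mem, smul_eq_mul, Ideal.mul_top] at hL
  have hLK (l : ℕ) : L ∈ K l := by
    rw [← Ideal.iInf_sup_maximalIdeal_pow (K l), Ideal.mem_iInf]
    intro i
    rw [← sub_sub_cancel (y i) L]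
    have hle : K l ⊔ m ^ (n + i) ≤ K l ⊔ m ^ i :=
      sup_le_sup le_rfl (Ideal.pow_le_pow_right (Nat.le_add_left i n))
    exact sub_mem (hle (hy i l)) (Submodule.mem_sup_right (hL i))
  have hL0 : L = 0 := by
    rw [← Ideal.mem_bot, ← hbot]
    exact Ideal.mem_iInf.mpr hLK
  have h1 := hL n
  have h2 := hmono 0 n
  rw [hL0, sub_zero] at h1
  rw [zero_add, add_zero] at h2
  have h3 := sub_mem h1 h2
  rw [sub_sub_cancel] at h3
  exact h3

/-- Let `Q` be a minimal prime of a principal ideal `(u)` in a Noetherian domain. Then every nonzero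
principal ideal of the localization at `Q` contains a power of `u`. -/
theorem Ideal.exists_pow_mem_span_singleton_localization {B : Type*} [CommRing B] [IsDomain B]
    [IsNoetherianRing B] {u b : B} (hb : b ≠ 0) {Q : Ideal B} [Q.IsPrime]
    (hQ : Q ∈ (Ideal.span {u}).minimalPrimes) :
    ∃ s : ℕ, algebraMap B (Localization.AtPrime Q) u ^ s ∈
      Ideal.span {algebraMap B (Localization.AtPrime Q) b} := by
  rw [← Ideal.mem_radical_iff, Ideal.radical_eq_sInf, Ideal.mem_sInf]
  rintro P ⟨hbP, hP⟩
  have hle : P.comap (algebraMap B (Localization.AtPrime Q)) ≤ Q :=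
    (Ideal.comap_mono (le_maximalIdeal hP.ne_top)).trans
      (Localization.AtPrime.under_maximalIdeal (I := Q)).le
  have hmem : b ∈ P.comap (algebraMap B (Localization.AtPrime Q)) := by
    simpa [Ideal.span_le] using hbP
  have huQ : u ∈ Q := hQ.1.2 (Ideal.mem_span_singleton_self u)
  suffices h : P.comap (algebraMap B (Localization.AtPrime Q)) = Q from
    Ideal.mem_comap.mp (h.ge huQ)
  by_contra hne
  have hlt := Ideal.height_strict_mono_of_isPrime (lt_of_le_of_ne hle hne)
  have h0 := Order.lt_one_iff.mp
    (hlt.trans_le (Ideal.height_le_one_of_isPrincipal_of_mem_minimalPrimes _ Q hQ))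
  rw [Ideal.height_eq_zero_iff, IsDomain.minimalPrimes_eq_singleton_bot,
    Set.mem_singleton_iff] at h0
  rw [h0] at hmem
  exact hb hmem

/-- An element of the extended Rees algebra of `I` has its coefficient of degree `n` in `I ^ n`. -/
theorem LaurentPolynomial.coeff_mem_pow_of_mem_adjoin {D : Type*} [CommRing D] {I : Ideal D}
    {s : Set D} (hs : s ⊆ I) {f : D[T;T⁻¹]}
    (hf : f ∈ Algebra.adjoin D (insert (T (-1)) ((fun a : D ↦ a • T 1) '' s)))
    (n : ℤ) : f.coeff n ∈ I ^ n.toNat := by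
  induction hf using Algebra.adjoin_induction generalizing n with
  | mem g hg =>
    obtain rfl | ⟨a, ha, rfl⟩ := hg
    · rw [T_apply]
      split_ifs with h
      · simp [← h]
      · exact zero_mem _
    · rw [AddMonoidAlgebra.coeff_smul_apply, T_apply]
      split_ifs with h
      · simpa [← h] using hs ha
      · simp
  | algebraMap r =>
    rw [← C_eq_algebraMap, C_apply]
    split_ifs with h
    · simp [h]
    · exact zero_mem _
  | add f g _ _ hf hg => exact add_mem (hf n) (hg n)
  | mul f g _ _ hf hg =>
    rw [AddMonoidAlgebra.coeff_mul]
    refine sum_mem fun i _ ↦ sum_mem fun j _ ↦ ?_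
    dsimp only
    split_ifs with h
    · refine Ideal.pow_le_pow_right (m := n.toNat) (n := i.toNat + j.toNat) (by lia) ?_
      rw [pow_add]
      exact Ideal.mul_mem_mul (hf i) (hg j)
    · exact zero_mem _

theorem eq_zero_of_forall_exists_pow_mem_pow {D : Type*} [CommRing D] [IsDomain D]
    [IsNoetherianRing D] {I : Ideal D} (hI : I ≠ ⊤) {x : D}
    (hx : ∀ k, ∃ c, ∀ j, x ^ (j + c) ∈ I ^ (k * j)) : x = 0 := by
  classical
  obtain ⟨s, hs⟩ := I.fg_of_isNoetherianRing
  let B : Subalgebra D D[T;T⁻¹] := Algebra.adjoin D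
    (insert (LaurentPolynomial.T (-1)) ((fun a : D ↦ a • LaurentPolynomial.T 1) '' (s : Set D)))
  have : Algebra.FiniteType D B := B.fg_iff_finiteType.mp <| Subalgebra.fg_def.mpr
    ⟨_, (s.finite_toSet.image _).insert _, rfl⟩
  have : IsNoetherianRing B := Algebra.FiniteType.isNoetherianRing D B
  have hP (n : ℕ) : I ^ n ≤ (Subalgebra.toSubmodule B).comap
      (LinearMap.toSpanSingleton D D[T;T⁻¹] (LaurentPolynomial.T n)) := by
    induction n with
    | zero =>
      intro a _
      simpa using B.smul_mem B.one_mem a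
    | succ n ih =>
      have h1 : ∀ b ∈ I, b • LaurentPolynomial.T 1 ∈ B := by
        change I ≤ (Subalgebra.toSubmodule B).comap
          (LinearMap.toSpanSingleton D D[T;T⁻¹] (LaurentPolynomial.T 1))
        rw [← hs, Ideal.span_le]
        intro a ha
        exact Algebra.subset_adjoin (Set.mem_insert_of_mem _ ⟨a, ha, rfl⟩)
      rw [pow_succ, Ideal.mul_le]
      intro a ha b hb
      have := B.mul_mem (ih ha) (h1 b hb)
      rw [LinearMap.toSpanSingleton_apply, smul_mul_smul_comm, ← LaurentPolynomial.T_add] at this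
      exact_mod_cast this
  let u : B := ⟨LaurentPolynomial.T (-1), Algebra.subset_adjoin (Set.mem_insert _ _)⟩
  have hpow {n : ℕ} {a : D} (ha : a ∈ I ^ n) : u ^ n ∣ algebraMap D B a := by
    refine ⟨⟨_, hP n ha⟩, Subtype.ext ?_⟩
    change algebraMap D D[T;T⁻¹] a = LaurentPolynomial.T (-1) ^ n * a • LaurentPolynomial.T n
    rw [mul_smul_comm, LaurentPolynomial.T_pow, ← LaurentPolynomial.T_add, mul_neg_one,
      neg_add_cancel, LaurentPolynomial.T_zero, Algebra.algebraMap_eq_smul_one]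
  have hT : LaurentPolynomial.T 1 * (u : D[T;T⁻¹]) = 1 := by
    rw [← LaurentPolynomial.T_add, add_neg_cancel, LaurentPolynomial.T_zero]
  have hu0 : u ≠ 0 := by
    rintro h
    simp [h] at hT
  have hu : ¬ IsUnit u := by
    intro h
    obtain ⟨v, hv⟩ := h.exists_right_inv
    have hv' : (v : D[T;T⁻¹]) = LaurentPolynomial.T 1 := by
      have : (u : D[T;T⁻¹]) * v = 1 := congrArg Subtype.val hv
      exact (left_inv_eq_right_inv hT this).symm
    have h1 := LaurentPolynomial.coeff_mem_pow_of_mem_adjoin (I := I)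
      (hs ▸ Ideal.subset_span) v.2 1
    rw [hv', LaurentPolynomial.T_apply, if_pos rfl, Int.toNat_one, pow_one] at h1
    exact hI (I.eq_top_iff_one.mpr h1)
  by_contra hx0
  have hb : algebraMap D B x ≠ 0 := by
    intro h
    have := congrArg (fun f : B ↦ (f : D[T;T⁻¹]).coeff 0) h
    change (algebraMap D D[T;T⁻¹] x).coeff 0 = 0 at this
    rw [← LaurentPolynomial.C_eq_algebraMap, LaurentPolynomial.C_apply, if_pos rfl] at this
    exact hx0 this
  obtain ⟨Q, hQ⟩ := Ideal.nonempty_minimalPrimes (I := Ideal.span {u})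
    (by rwa [Ne, Ideal.span_singleton_eq_top])
  have := hQ.1.1
  obtain ⟨r, hr⟩ := Ideal.exists_pow_mem_span_singleton_localization hb hQ
  obtain ⟨w, hw⟩ := Ideal.mem_span_singleton.mp hr
  obtain ⟨c, hc⟩ := hx (r + 1)
  obtain ⟨z, hz⟩ := hpow (hc (r * c + 1))
  set φ := algebraMap B (Localization.AtPrime Q)
  have hinj : Function.Injective φ :=
    IsLocalization.injective (Localization.AtPrime Q) Q.primeCompl_le_nonZeroDivisors
  have huQ : u ∈ Q := hQ.1.2 (Ideal.mem_span_singleton_self u)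
  have key : φ u ^ (r * (r * c + 1 + c)) * (φ u * (φ z * w ^ (r * c + 1 + c))) =
      φ u ^ (r * (r * c + 1 + c)) * 1 := by
    rw [mul_one]
    conv_rhs => rw [pow_mul, hw, mul_pow, ← map_pow, ← map_pow, hz, map_mul, map_pow]
    ring
  have h1 := mul_left_cancel₀ (pow_ne_zero _ ((map_ne_zero_iff φ hinj).mpr hu0)) key
  exact (IsLocalization.AtPrime.isUnit_to_map_iff (Localization.AtPrime Q) Q u).mp
    (IsUnit.of_mul_eq_one _ h1) huQ

/-- The ideal of all `x` such that `x ^ (j + c) ∈ I ^ (k * j)` for some `c` and all `j`, that is,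
of all `x` whose powers asymptotically have `I`-adic order at least `k` times the exponent. -/
def Ideal.asymptoticPow {A : Type*} [CommRing A] (I : Ideal A) (k : ℕ) : Ideal A where
  carrier := {x | ∃ c, ∀ j, x ^ (j + c) ∈ I ^ (k * j)}
  zero_mem' := ⟨1, fun j ↦ by simp⟩
  smul_mem' a x := fun ⟨c, hc⟩ ↦ ⟨c, fun j ↦ by
    rw [smul_eq_mul, mul_pow]
    exact Ideal.mul_mem_left _ _ (hc j)⟩
  add_mem' := by
    have aux {x : A} {c : ℕ} (hc : ∀ j, x ^ (j + c) ∈ I ^ (k * j)) (a : ℕ) :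
        x ^ a ∈ I ^ (k * (a - c)) := by
      obtain h | h := le_total c a
      · simpa [Nat.sub_add_cancel h] using hc (a - c)
      · simp [Nat.sub_eq_zero_of_le h]
    rintro x y ⟨c, hc⟩ ⟨d, hd⟩
    refine ⟨c + d, fun j ↦ ?_⟩
    rw [add_pow]
    refine Ideal.sum_mem _ fun a ha ↦ Ideal.mul_mem_right _ _ ?_
    rw [Finset.mem_range] at ha
    refine Ideal.pow_le_pow_right (n := k * (a - c) + k * (j + (c + d) - a - d)) ?_ ?_
    · rw [← mul_add]
      exact Nat.mul_le_mul_left k (by lia)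
    · rw [pow_add]
      exact Ideal.mul_mem_mul (aux hc a) (aux hd _)

theorem Ideal.mem_asymptoticPow {A : Type*} [CommRing A] {I : Ideal A} {k : ℕ} {x : A} :
    x ∈ I.asymptoticPow k ↔ ∃ c, ∀ j, x ^ (j + c) ∈ I ^ (k * j) :=
  Iff.rfl

theorem Ideal.asymptoticPow_antitone {A : Type*} [CommRing A] (I : Ideal A) :
    Antitone I.asymptoticPow :=
  fun _ _ h _ ⟨c, hc⟩ ↦ ⟨c, fun j ↦ Ideal.pow_le_pow_right (Nat.mul_le_mul_right j h) (hc j)⟩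

theorem Ideal.mem_asymptoticPow_of_sq_mem {A : Type*} [CommRing A] {I : Ideal A} {k : ℕ} {x : A}
    (hx : x ^ 2 ∈ I ^ (2 * k)) : x ∈ I.asymptoticPow k := by
  refine ⟨1, fun j ↦ ?_⟩
  have h := Ideal.pow_mem_pow hx ((j + 1) / 2)
  rw [← pow_mul, ← pow_mul] at h
  have h1 : j + 1 = 2 * ((j + 1) / 2) + (j + 1) % 2 := (Nat.div_add_mod _ _).symm
  rw [h1, pow_add]
  refine Ideal.mul_mem_right _ _ (Ideal.pow_le_pow_right ?_ h)
  rw [mul_comm 2 k, mul_assoc]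
  exact Nat.mul_le_mul_left k (by lia)

theorem Ideal.iInf_asymptoticPow_eq_bot {A : Type*} [CommRing A] [IsLocalRing A]
    [IsNoetherianRing A] [IsReduced A] {I : Ideal A} (hI : I ≠ ⊤) :
    ⨅ k, I.asymptoticPow k = ⊥ := by
  refine eq_bot_iff.mpr fun x hx ↦ ?_
  rw [Ideal.mem_iInf] at hx
  refine IsReduced.eq_zero x (nilpotent_iff_mem_prime.mpr fun P hP ↦ ?_)
  rw [← Ideal.Quotient.eq_zero_iff_mem]
  refine eq_zero_of_forall_exists_pow_mem_pow (I := I.map (Ideal.Quotient.mk P)) (fun h ↦ ?_)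
    fun k ↦ ?_
  · have h1 := congrArg (Ideal.comap (Ideal.Quotient.mk P)) h
    rw [Ideal.comap_map_quotientMk, Ideal.comap_top] at h1
    exact maximalIdeal.isMaximal A |>.ne_top <| top_le_iff.mp <| h1.ge.trans <|
      sup_le (le_maximalIdeal hP.ne_top) (le_maximalIdeal hI)
  · obtain ⟨c, hc⟩ := hx k
    refine ⟨c, fun j ↦ ?_⟩
    rw [← map_pow, ← Ideal.map_pow]
    exact Ideal.mem_map_of_mem _ (hc j)

theorem mem_maximalIdeal_pow_iff_le_ordR {R : Type u} [CommRing R] [IsLocalRing R]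
    [IsNoetherianRing R] {x : R} (hx : x ≠ 0) {n : ℕ} :
    x ∈ maximalIdeal R ^ n ↔ n ≤ ordR R x := by
  have hbdd : BddAbove {n : ℕ | x ∈ maximalIdeal R ^ n} := by
    have h : x ∉ ⨅ i : ℕ, maximalIdeal R ^ i := by
      rwa [Ideal.iInf_pow_eq_bot_of_isLocalRing _ (maximalIdeal.isMaximal R).ne_top]
    rw [Ideal.mem_iInf, not_forall] at h
    obtain ⟨N, hN⟩ := h
    exact ⟨N, fun i hi ↦ le_of_not_ge fun hNi ↦ hN (Ideal.pow_le_pow_right hNi hi)⟩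
  exact ⟨fun h ↦ le_csSup hbdd h,
    fun h ↦ Ideal.pow_le_pow_right h (Nat.sSup_mem ⟨0, by simp⟩ hbdd)⟩

theorem AdicCompletion.mem_pow_of_algebraMap_mem_map_pow {R : Type*} [CommRing R] {I : Ideal R}
    {n : ℕ} {x : R} (hx : algebraMap R (AdicCompletion I R) x ∈
      I.map (algebraMap R (AdicCompletion I R)) ^ n) : x ∈ I ^ n := by
  have hle : (I ^ n).map (algebraMap R (AdicCompletion I R)) ≤
      RingHom.ker (evalₐ I n : AdicCompletion I R →+* R ⧸ I ^ n) := by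
    rw [Ideal.map_le_iff_le_comap]
    intro a ha
    rw [Ideal.mem_comap, RingHom.mem_ker, RingHom.coe_coe, AlgHom.commutes]
    exact Ideal.Quotient.eq_zero_iff_mem.mpr ha
  rw [← Ideal.map_pow] at hx
  have h := hle hx
  rw [RingHom.mem_ker, RingHom.coe_coe, AlgHom.commutes] at h
  exact Ideal.Quotient.eq_zero_iff_mem.mp h

theorem analytically_unramified_iff_bounded_squares
    (R : Type u) [CommRing R] [IsLocalRing R] [IsNoetherianRing R] :
    IsReduced (AdicCompletion (IsLocalRing.maximalIdeal R) R) ↔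
      ∃ ν : ℕ → ℕ, ∀ x : R, x ≠ 0 → x ^ 2 ≠ 0 ∧ ordR R (x ^ 2) ≤ ν (ordR R x) := by
  constructor
  · intro _
    have := AdicCompletion.isNoetherianRing (maximalIdeal R)
    choose k hk using Ideal.exists_le_maximalIdeal_pow_of_iInf_eq_bot
      (Ideal.asymptoticPow_antitone (maximalIdeal (AdicCompletion (maximalIdeal R) R)))
      (Ideal.iInf_asymptoticPow_eq_bot (maximalIdeal.isMaximal _).ne_top)
    refine ⟨fun n ↦ 2 * k (n + 1), fun x hx ↦ ?_⟩
    have hsq : x ^ 2 ∉ maximalIdeal R ^ (2 * k (ordR R x + 1)) := by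
      intro h
      have h1 := Ideal.mem_map_of_mem (algebraMap R (AdicCompletion (maximalIdeal R) R)) h
      rw [Ideal.map_pow, ← AdicCompletion.maximalIdeal_eq_map, map_pow] at h1
      have h2 := hk _ (Ideal.mem_asymptoticPow_of_sq_mem h1)
      rw [AdicCompletion.maximalIdeal_eq_map] at h2
      have h3 := AdicCompletion.mem_pow_of_algebraMap_mem_map_pow h2
      rw [mem_maximalIdeal_pow_iff_le_ordR hx] at h3
      lia
    have h0 : x ^ 2 ≠ 0 := fun h ↦ hsq (h ▸ zero_mem _)
    rw [mem_maximalIdeal_pow_iff_le_ordR h0] at hsq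
    exact ⟨h0, (not_le.mp hsq).le⟩
  · rintro ⟨ν, hν⟩
    refine (isReduced_iff_pow_one_lt 2 one_lt_two).mpr fun z ↦ ?_
    induction z using AdicCompletion.induction_on with | _ f =>
    intro hz
    refine AdicCompletion.ext_evalₐ fun n ↦ ?_
    rw [AdicCompletion.evalₐ_mk, map_zero, Ideal.Quotient.eq_zero_iff_mem]
    by_contra hn
    let N := n + ∑ i ∈ Finset.range n, (ν i + 1)
    have hfN : f.val N ∉ maximalIdeal R ^ n := by
      intro h
      have h1 := f.2 (Nat.le_add_right n _ : n ≤ N)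
      rw [SModEq.sub_mem, smul_eq_mul, Ideal.mul_top] at h1
      exact hn ((Submodule.sub_mem_iff_left _ h).mp h1)
    have h0 : f.val N ≠ 0 := fun h ↦ hfN (h ▸ zero_mem _)
    have hsq : f.val N ^ 2 ∈ maximalIdeal R ^ N := by
      rw [← Ideal.Quotient.eq_zero_iff_mem, map_pow, ← AdicCompletion.evalₐ_mk, ← map_pow, hz,
        map_zero]
    obtain ⟨h1, h2⟩ := hν _ h0
    rw [mem_maximalIdeal_pow_iff_le_ordR h1] at hsq
    rw [mem_maximalIdeal_pow_iff_le_ordR h0, not_le] at hfN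
    have h3 := Finset.single_le_sum (f := fun i ↦ ν i + 1) (fun _ _ ↦ Nat.zero_le _)
      (Finset.mem_range.mpr hfN)
    lia
end
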